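/- arXiv:2507.17571 — 6 statements merged into one kernel-verified Lean document; each statement's English description precedes it below -/
import Mathlib

section
/- Characterization of Hamming (n,ℓ,σ)-equivalence for skew trinomial codes. Let 0 < ℓ < n be integers and let a₀, a_ℓ, b₀, b_ℓ be nonzero elements of 𝔽_q. Then the following are equivalent: (i) there exists a nonzero α ∈ 𝔽_q with a₀·N_n^σ(α) = b₀ and a_ℓ·N_{n−ℓ}^σ(σ^ℓ(α)) = b_ℓ; (ii) the pair (a₀^{−1}b₀, a_ℓ^{−1}b_ℓ) belongs to the cyclic subgroup of 𝔽_q^* × 𝔽_q^* generated by (N_n^σ(ξ), N_{n−ℓ}^σ(σ^ℓ(ξ))). -/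
/-- `sNorm σ i α = σ^{i-1}(α) ⋯ σ(α) · α`, the `i`-th skew norm of `α`. -/
def sNorm {F : Type*} [Field F] (σ : F ≃+* F) (i : ℕ) (α : F) : F :=
  ∏ j ∈ Finset.range i, (⇑σ)^[j] α

theorem sNorm_pow {F : Type*} [Field F] (σ : F ≃+* F) (i m : ℕ) (α : F) :
    sNorm σ i (α ^ m) = sNorm σ i α ^ m := by
  simp only [sNorm, iterate_map_pow, Finset.prod_pow]

/-- Characterization of Hamming `(n,ℓ,σ)`-equivalence for skew trinomial codes. -/
theorem hamming_equiv_iff_mem_cyclic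
    (p s : ℕ) (hp : p.Prime) (hs : 1 ≤ s)
    (F : Type*) [Field F] [Fintype F] (hF : Fintype.card F = p ^ s)
    (σ : F ≃+* F)
    (ξ : F) (hξ0 : ξ ≠ 0) (hξ : ∀ x : F, x ≠ 0 → ∃ m : ℕ, x = ξ ^ m)
    (ℓ n : ℕ) (hℓ : 0 < ℓ) (hℓn : ℓ < n)
    (a₀ aℓ b₀ bℓ : F) (ha₀ : a₀ ≠ 0) (haℓ : aℓ ≠ 0) (hb₀ : b₀ ≠ 0) (hbℓ : bℓ ≠ 0) :
    (∃ α : F, α ≠ 0 ∧ a₀ * sNorm σ n α = b₀ ∧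
        aℓ * sNorm σ (n - ℓ) ((⇑σ)^[ℓ] α) = bℓ) ↔
    (∃ m : ℕ, a₀⁻¹ * b₀ = (sNorm σ n ξ) ^ m ∧
        aℓ⁻¹ * bℓ = (sNorm σ (n - ℓ) ((⇑σ)^[ℓ] ξ)) ^ m) := by
  constructor
  · rintro ⟨α, hα, h₀, hl⟩
    obtain ⟨m, rfl⟩ := hξ α hα
    rw [iterate_map_pow, sNorm_pow] at hl
    rw [sNorm_pow] at h₀
    exact ⟨m, by rw [← h₀, inv_mul_cancel_left₀ ha₀], by rw [← hl, inv_mul_cancel_left₀ haℓ]⟩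
  · rintro ⟨m, h₀, hl⟩
    refine ⟨ξ ^ m, pow_ne_zero m hξ0, ?_, ?_⟩
    · rw [sNorm_pow, ← h₀, mul_inv_cancel_left₀ ha₀]
    · rw [iterate_map_pow, sNorm_pow, ← hl, mul_inv_cancel_left₀ haℓ]
end

section
/- Number of Hamming (n,ℓ,σ)-equivalence classes for skew trinomial codes. Let 0 < ℓ < n be integers. The cyclic subgroup H_{ℓ,σ} of 𝔽_q^* × 𝔽_q^* generated by the pair (N_n^σ(ξ), N_{n−ℓ}^σ(σ^ℓ(ξ))) has index (q−1)² / lcm( (q−1)/gcd([n]_r, q−1), (q−1)/gcd([n−ℓ]_r, q−1) ) in 𝔽_q^* × 𝔽_q^*. -/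
/-- `brk p r i = [i]_r = 1 + p^r + ⋯ + p^{r(i-1)} = (p^{ri} - 1)/(p^r - 1)`. -/
def brk (p r i : ℕ) : ℕ := ∑ j ∈ Finset.range i, p ^ (r * j)

theorem iterate_eq_pow_of_eq_pow {M : Type*} [Monoid M] {f : M → M} {k : ℕ}
    (hf : ∀ a, f a = a ^ k) (j : ℕ) (a : M) : f^[j] a = a ^ k ^ j := by
  induction j with
  | zero => simp
  | succ j ih => rw [Function.iterate_succ_apply', ih, hf, ← pow_mul, pow_succ]

theorem sNorm_eq_pow_brk {F : Type*} [Field F] {σ : F ≃+* F} {p r : ℕ}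
    (hσ : ∀ a : F, σ a = a ^ p ^ r) (i : ℕ) (α : F) : sNorm σ i α = α ^ brk p r i := by
  simp only [sNorm, brk, iterate_eq_pow_of_eq_pow hσ, ← pow_mul, Finset.prod_pow_eq_pow_sum]

theorem orderOf_iterate_mulEquiv {M : Type*} [Monoid M] (σ : M ≃* M) (j : ℕ) (a : M) :
    orderOf (σ^[j] a) = orderOf a := by
  induction j with
  | zero => rfl
  | succ j ih => rw [Function.iterate_succ_apply', MulEquiv.orderOf_eq, ih]

theorem orderOf_eq_card_sub_one_of_forall_eq_pow {F : Type*} [Field F] [Fintype F] {ξ : F}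
    (hξ0 : ξ ≠ 0) (hξ : ∀ x : F, x ≠ 0 → ∃ m : ℕ, x = ξ ^ m) :
    orderOf ξ = Fintype.card F - 1 := by
  classical
  have hgen : ∀ x : Fˣ, x ∈ Subgroup.zpowers (Units.mk0 ξ hξ0) := by
    intro x
    obtain ⟨m, hm⟩ := hξ x x.ne_zero
    exact ⟨m, Units.ext (by simp [hm])⟩
  rw [← Fintype.card_units, ← Nat.card_eq_fintype_card, ← orderOf_eq_card_of_forall_mem_zpowers hgen,
    ← orderOf_units, Units.val_mk0]

theorem orderOf_eq_of_val_eq_sNorm {F : Type*} [Field F] [Fintype F] {σ : F ≃+* F} {p r : ℕ}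
    (hσ : ∀ a : F, σ a = a ^ p ^ r) {i : ℕ} {α : F} (hα : α ≠ 0) {u : Fˣ}
    (hu : (u : F) = sNorm σ i α) :
    orderOf u = orderOf α / Nat.gcd (brk p r i) (orderOf α) := by
  have hpow : u = Units.mk0 α hα ^ brk p r i := Units.ext (by simp [hu, sNorm_eq_pow_brk hσ])
  rw [hpow, orderOf_pow, ← orderOf_units, Units.val_mk0, Nat.gcd_comm]

/-- Number of Hamming `(n,ℓ,σ)`-equivalence classes for skew trinomial codes:
the index of the cyclic subgroup `H_{ℓ,σ}` of `𝔽_q^* × 𝔽_q^*` generated by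
`(N_n^σ(ξ), N_{n−ℓ}^σ(σ^ℓ(ξ)))`. -/
theorem hamming_equiv_num_classes
    (p s r : ℕ) (hp : p.Prime) (hs : 1 ≤ s) (hr : r < s)
    (F : Type*) [Field F] [Fintype F] (hF : Fintype.card F = p ^ s)
    (σ : F ≃+* F) (hσ : ∀ a : F, σ a = a ^ p ^ r)
    (ξ : F) (hξ0 : ξ ≠ 0) (hξ : ∀ x : F, x ≠ 0 → ∃ m : ℕ, x = ξ ^ m)
    (ℓ n : ℕ) (hℓ : 0 < ℓ) (hℓn : ℓ < n)
    (u₀ uℓ : Fˣ)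
    (hu₀ : (u₀ : F) = sNorm σ n ξ)
    (huℓ : (uℓ : F) = sNorm σ (n - ℓ) ((⇑σ)^[ℓ] ξ)) :
    (Subgroup.zpowers ((u₀, uℓ) : Fˣ × Fˣ)).index =
      (p ^ s - 1) ^ 2 /
        Nat.lcm ((p ^ s - 1) / Nat.gcd (brk p r n) (p ^ s - 1))
          ((p ^ s - 1) / Nat.gcd (brk p r (n - ℓ)) (p ^ s - 1)) := by
  classical
  have hord : orderOf ξ = p ^ s - 1 := hF ▸ orderOf_eq_card_sub_one_of_forall_eq_pow hξ0 hξ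
  have hordℓ : orderOf ((⇑σ)^[ℓ] ξ) = p ^ s - 1 :=
    (orderOf_iterate_mulEquiv σ.toMulEquiv ℓ ξ).trans hord
  have hξℓ : (⇑σ)^[ℓ] ξ ≠ 0 := by
    rw [iterate_eq_pow_of_eq_pow hσ]
    exact pow_ne_zero _ hξ0
  have h₀ := orderOf_eq_of_val_eq_sNorm hσ hξ0 hu₀
  have hℓ' := orderOf_eq_of_val_eq_sNorm hσ hξℓ huℓ
  rw [hord] at h₀
  rw [hordℓ] at hℓ'
  rw [← h₀, ← hℓ', ← Prod.orderOf_mk]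
  have hcard : Nat.card (Fˣ × Fˣ) = (p ^ s - 1) ^ 2 := by
    rw [Nat.card_prod, Nat.card_eq_fintype_card, Fintype.card_units, hF, sq]
  rw [← hcard, ← (Subgroup.zpowers (u₀, uℓ)).card_mul_index, Nat.card_zpowers,
    Nat.mul_div_cancel_left _ (orderOf_pos _)]
end

section
/- Hamming equivalence to the trinomial x^n − x^ℓ − 1. Let 0 < ℓ < n be integers and let a₀, a_ℓ be nonzero elements of 𝔽_q. Then the following are equivalent: (i) there exists a nonzero α ∈ 𝔽_q with a₀·N_n^σ(α) = 1 and a_ℓ·N_{n−ℓ}^σ(σ^ℓ(α)) = 1; (ii) there exists a nonzero β ∈ 𝔽_q with N_n^σ(β) = a₀ and a₀ = N_ℓ^σ(β)·a_ℓ. -/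
theorem sNorm_inv {F : Type*} [Field F] (σ : F ≃+* F) (i : ℕ) (α : F) :
    sNorm σ i α⁻¹ = (sNorm σ i α)⁻¹ := by
  unfold sNorm
  rw [← Finset.prod_inv_distrib]
  exact Finset.prod_congr rfl fun j _ =>
    (show Function.Commute (⇑σ) Inv.inv from map_inv₀ σ).iterate_left j α

theorem sNorm_add {F : Type*} [Field F] (σ : F ≃+* F) (i j : ℕ) (α : F) :
    sNorm σ (i + j) α = sNorm σ i α * sNorm σ j ((⇑σ)^[i] α) := by
  simp only [sNorm, Finset.prod_range_add, ← Function.iterate_add_apply, add_comm]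

/-- Hamming equivalence to the trinomial `x^n − x^ℓ − 1`. -/
theorem hamming_equiv_to_unit_trinomial
    (p s : ℕ) (hp : p.Prime) (hs : 1 ≤ s)
    (F : Type*) [Field F] [Fintype F] (hF : Fintype.card F = p ^ s)
    (σ : F ≃+* F)
    (ℓ n : ℕ) (hℓ : 0 < ℓ) (hℓn : ℓ < n)
    (a₀ aℓ : F) (ha₀ : a₀ ≠ 0) (haℓ : aℓ ≠ 0) :
    (∃ α : F, α ≠ 0 ∧ a₀ * sNorm σ n α = 1 ∧
        aℓ * sNorm σ (n - ℓ) ((⇑σ)^[ℓ] α) = 1) ↔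
    (∃ β : F, β ≠ 0 ∧ sNorm σ n β = a₀ ∧ a₀ = sNorm σ ℓ β * aℓ) := by
  obtain ⟨k, rfl⟩ := Nat.exists_eq_add_of_lt hℓn
  rw [add_assoc, Nat.add_sub_cancel_left]
  constructor
  · rintro ⟨α, hα, h₀, hₗ⟩
    refine ⟨α⁻¹, inv_ne_zero hα, ?_, ?_⟩
    · rw [sNorm_inv, eq_inv_of_mul_eq_one_left h₀]
    · rw [eq_inv_of_mul_eq_one_left h₀, eq_inv_of_mul_eq_one_left hₗ, sNorm_inv, sNorm_add,
        mul_inv]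
  · rintro ⟨β, hβ, h₀, hₗ⟩
    have hinv : (⇑σ)^[ℓ] β⁻¹ = ((⇑σ)^[ℓ] β)⁻¹ :=
      (show Function.Commute (⇑σ) Inv.inv from map_inv₀ σ).iterate_left ℓ β
    refine ⟨β⁻¹, inv_ne_zero hβ, ?_, ?_⟩
    · rw [sNorm_inv, h₀, mul_inv_cancel₀ ha₀]
    · have hN : sNorm σ ℓ β ≠ 0 := left_ne_zero_of_mul (hₗ ▸ ha₀)
      rw [hₗ, sNorm_add] at h₀
      rw [hinv, sNorm_inv, mul_left_cancel₀ hN h₀, mul_inv_cancel₀ haℓ]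
end

section
/- Characterization of rank equivalence over the fixed subfield. Let 0 < ℓ < n be integers and let a₀, a_ℓ, b₀, b_ℓ be nonzero elements of 𝔽_q. Then the following are equivalent: (i) there exists a nonzero α ∈ 𝔽_q^σ with a₀·N_n^σ(α) = b₀ and a_ℓ·N_{n−ℓ}^σ(σ^ℓ(α)) = b_ℓ; (ii) there exists a nonzero α ∈ 𝔽_q^σ with a₀·α^n = b₀ and a_ℓ·α^{n−ℓ} = b_ℓ; (iii) the pair (a₀^{−1}b₀, a_ℓ^{−1}b_ℓ) belongs to the cyclic subgroup of 𝔽_q^* × 𝔽_q^* generated by (ζ^n, ζ^{n−ℓ}). -/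
/-- On a fixed point of `σ` the skew norm is an ordinary power. -/
theorem sNorm_eq_pow_of_fixed {F : Type*} [Field F] (σ : F ≃+* F) (i : ℕ) {α : F}
    (h : σ α = α) : sNorm σ i α = α ^ i := by
  simp [sNorm, Function.iterate_fixed h]

/-- Characterization of rank equivalence over the fixed subfield `𝔽_q^σ`. -/
theorem rank_equiv_fixed_subfield_characterization
    (p s : ℕ) (hp : p.Prime) (hs : 1 ≤ s)
    (F : Type*) [Field F] [Fintype F] (hF : Fintype.card F = p ^ s)
    (σ : F ≃+* F)
    (ζ : F) (hζfix : σ ζ = ζ) (hζ0 : ζ ≠ 0)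
    (hζ : ∀ x : F, σ x = x → x ≠ 0 → ∃ m : ℕ, x = ζ ^ m)
    (ℓ n : ℕ) (hℓ : 0 < ℓ) (hℓn : ℓ < n)
    (a₀ aℓ b₀ bℓ : F) (ha₀ : a₀ ≠ 0) (haℓ : aℓ ≠ 0) (hb₀ : b₀ ≠ 0) (hbℓ : bℓ ≠ 0) :
    ((∃ α : F, σ α = α ∧ α ≠ 0 ∧ a₀ * sNorm σ n α = b₀ ∧
        aℓ * sNorm σ (n - ℓ) ((⇑σ)^[ℓ] α) = bℓ) ↔
      (∃ α : F, σ α = α ∧ α ≠ 0 ∧ a₀ * α ^ n = b₀ ∧ aℓ * α ^ (n - ℓ) = bℓ)) ∧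
    ((∃ α : F, σ α = α ∧ α ≠ 0 ∧ a₀ * α ^ n = b₀ ∧ aℓ * α ^ (n - ℓ) = bℓ) ↔
      (∃ m : ℕ, a₀⁻¹ * b₀ = (ζ ^ n) ^ m ∧ aℓ⁻¹ * bℓ = (ζ ^ (n - ℓ)) ^ m)) := by
  refine ⟨exists_congr fun α => and_congr_right fun h => ?_, ?_, ?_⟩
  · rw [Function.iterate_fixed h, sNorm_eq_pow_of_fixed σ n h, sNorm_eq_pow_of_fixed σ (n - ℓ) h]
  · rintro ⟨α, hα, hα0, rfl, rfl⟩
    obtain ⟨m, rfl⟩ := hζ α hα hα0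
    refine ⟨m, ?_, ?_⟩
    · rw [inv_mul_cancel_left₀ ha₀, pow_right_comm]
    · rw [inv_mul_cancel_left₀ haℓ, pow_right_comm]
  · rintro ⟨m, h₀, h₁⟩
    refine ⟨ζ ^ m, by rw [map_pow, hζfix], pow_ne_zero m hζ0, ?_, ?_⟩
    · rw [pow_right_comm, ← h₀, mul_inv_cancel_left₀ ha₀]
    · rw [pow_right_comm, ← h₁, mul_inv_cancel_left₀ haℓ]
end

section
/- Rank equivalence to the trinomial x^n − x^ℓ − 1. Let 0 < ℓ < n be integers and let a₀, a_ℓ be nonzero elements of 𝔽_q. Then the following are equivalent: (i) there exists a nonzero α ∈ 𝔽_{q'} with a₀·N_n^σ(α) = 1 and a_ℓ·N_{n−ℓ}^σ(σ^ℓ(α)) = 1; (ii) there exists a nonzero β ∈ 𝔽_{q'} with N_n^σ(β) = a₀ and a₀ = N_ℓ^σ(β)·a_ℓ. -/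
theorem sNorm_ne_zero {F : Type*} [Field F] (σ : F ≃+* F) (i : ℕ) {α : F} (hα : α ≠ 0) :
    sNorm σ i α ≠ 0 := by
  refine Finset.prod_ne_zero_iff.mpr fun j hj => ?_
  clear hj
  induction j with
  | zero => exact hα
  | succ j ih => simpa only [Function.iterate_succ_apply', ne_eq, map_eq_zero] using ih

/-- Rank equivalence to the trinomial `x^n − x^ℓ − 1`. -/
theorem rank_equiv_to_unit_trinomial
    (p s : ℕ) (hp : p.Prime) (hs : 1 ≤ s)
    (F : Type*) [Field F] [Fintype F] (hF : Fintype.card F = p ^ s)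
    (σ : F ≃+* F)
    (K' : Subfield F) (q' : ℕ) (hq' : Nat.card K' = q')
    (ℓ n : ℕ) (hℓ : 0 < ℓ) (hℓn : ℓ < n)
    (a₀ aℓ : F) (ha₀ : a₀ ≠ 0) (haℓ : aℓ ≠ 0) :
    (∃ α : F, α ∈ K' ∧ α ≠ 0 ∧ a₀ * sNorm σ n α = 1 ∧
        aℓ * sNorm σ (n - ℓ) ((⇑σ)^[ℓ] α) = 1) ↔
    (∃ β : F, β ∈ K' ∧ β ≠ 0 ∧ sNorm σ n β = a₀ ∧ a₀ = sNorm σ ℓ β * aℓ) := by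
  have norm_split (α : F) :
      sNorm σ n α = sNorm σ ℓ α * sNorm σ (n - ℓ) ((⇑σ)^[ℓ] α) := by
    rw [← sNorm_add, Nat.add_sub_cancel' hℓn.le]
  constructor
  · rintro ⟨α, hαK, hα, h₀, hl⟩
    refine ⟨α⁻¹, K'.inv_mem hαK, inv_ne_zero hα, ?_, ?_⟩
    · rw [sNorm_inv, eq_inv_of_mul_eq_one_left h₀]
    · rw [sNorm_inv, eq_inv_of_mul_eq_one_left h₀, eq_inv_of_mul_eq_one_left hl, norm_split,
        mul_inv]
  · rintro ⟨β, hβK, hβ, h₀, hl⟩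
    have hℓβ := sNorm_ne_zero σ ℓ hβ
    refine ⟨β⁻¹, K'.inv_mem hβK, inv_ne_zero hβ, ?_, ?_⟩
    · rw [sNorm_inv, h₀, mul_inv_cancel₀ ha₀]
    · have hsplit := norm_split β⁻¹
      rw [sNorm_inv, sNorm_inv, h₀, hl, mul_inv] at hsplit
      rw [← mul_left_cancel₀ (inv_ne_zero hℓβ) hsplit, mul_inv_cancel₀ haℓ]
end

section
/- Characterization and count of rank (n,σ,𝔽_{q'})-equivalence classes for skew polycyclic codes. Let n, m be positive integers, let i₀ < i₁ < ⋯ < i_{m−1} be natural numbers with i_{m−1} ≤ n−1, and let a = (a_{i₀},…,a_{i_{m−1}}) and b = (b_{i₀},…,b_{i_{m−1}}) be m-tuples of nonzero elements of 𝔽_q. Then: (1) there exists a nonzero α ∈ 𝔽_{q'} such that a_{i_j}·N_{n−i_j}^σ(σ^{i_j}(α)) = b_{i_j} for every j ∈ {0,…,m−1} if and only if the m-tuple (a_{i₀}^{−1}b_{i₀}, …, a_{i_{m−1}}^{−1}b_{i_{m−1}}) belongs to the cyclic subgroup H_{n,𝔽_{q'}} of (𝔽_q^*)^m generated by the m-tuple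 (N_{n−i₀}^σ(σ^{i₀}(ζ)), …, N_{n−i_{m−1}}^σ(σ^{i_{m−1}}(ζ))); and (2) the subgroup H_{n,𝔽_{q'}} has index (q−1)^m / lcm_{j ∈ {0,…,m−1}}( (q'−1)/gcd([n−i_j]_r, q'−1) ) in (𝔽_q^*)^m. -/
theorem iterate_eq_pow_of_forall_eq_pow {F : Type*} [Field F] {σ : F ≃+* F} {p r : ℕ}
    (hσ : ∀ a : F, σ a = a ^ p ^ r) (k : ℕ) (α : F) : (⇑σ)^[k] α = α ^ p ^ (r * k) := by
  induction k with
  | zero => simp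
  | succ k ih => rw [Function.iterate_succ_apply', ih, hσ, ← pow_mul, ← pow_add, Nat.mul_succ]

theorem sNorm_iterate_pow {F : Type*} [Field F] (σ : F ≃+* F) (i k t : ℕ) (α : F) :
    sNorm σ i ((⇑σ)^[k] (α ^ t)) = sNorm σ i ((⇑σ)^[k] α) ^ t := by
  simp only [sNorm, iterate_map_pow, Finset.prod_pow]

theorem orderOf_iterate_ringEquiv {F : Type*} [Field F] (σ : F ≃+* F) (k : ℕ) (α : F) :
    orderOf ((⇑σ)^[k] α) = orderOf α := by
  induction k with
  | zero => rfl
  | succ k ih =>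
    rw [Function.iterate_succ_apply', ← ih]
    exact orderOf_injective (σ : F →* F) σ.injective _

/-- A generator of the nonzero elements of a finite subfield has order one less than the
cardinality of the subfield. -/
theorem orderOf_eq_natCard_subfield_sub_one {F : Type*} [Field F] [Finite F] (K : Subfield F)
    {ζ : F} (hζK : ζ ∈ K) (hζ0 : ζ ≠ 0) (hζ : ∀ x : F, x ∈ K → x ≠ 0 → ∃ t : ℕ, x = ζ ^ t) :
    orderOf ζ = Nat.card K - 1 := by
  have hζ0' : (⟨ζ, hζK⟩ : K) ≠ 0 := fun h => hζ0 (congrArg Subtype.val h)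
  have hgen : ∀ x : Kˣ, x ∈ Submonoid.powers (Units.mk0 _ hζ0') := by
    intro x
    obtain ⟨t, ht⟩ := hζ (x : K) (x : K).2 (fun h => x.ne_zero (Subtype.ext h))
    refine ⟨t, Units.ext (Subtype.ext ?_)⟩
    simpa using ht.symm
  rw [← Nat.card_units, ← orderOf_eq_card_of_forall_mem_powers hgen, ← orderOf_units]
  exact orderOf_injective (K.subtype : K →* F) K.subtype.injective ⟨ζ, hζK⟩

/-- The order of the skew norm of a shifted element, in terms of the order of that element. -/
theorem orderOf_sNorm_iterate {F : Type*} [Field F] [Finite F] {σ : F ≃+* F} {p r : ℕ}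
    (hσ : ∀ a : F, σ a = a ^ p ^ r) (i k : ℕ) {α : F} (hα : α ≠ 0) :
    orderOf (sNorm σ i ((⇑σ)^[k] α)) = orderOf α / Nat.gcd (brk p r i) (orderOf α) := by
  have hne : (⇑σ)^[k] α ≠ 0 := by
    rw [iterate_eq_pow_of_forall_eq_pow hσ]
    exact pow_ne_zero _ hα
  have h := orderOf_pow (n := brk p r i) (Units.mk0 _ hne)
  rw [← orderOf_units, ← orderOf_units, Units.val_pow_eq_pow_val, Units.val_mk0,
    orderOf_iterate_ringEquiv] at h
  rw [sNorm_eq_pow_brk hσ, h, Nat.gcd_comm]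

/-- Characterization and count of rank `(n,σ,𝔽_{q'})`-equivalence classes for
skew polycyclic codes. -/
theorem rank_equiv_polycyclic_characterization_and_count
    (p s r : ℕ) (hp : p.Prime) (hs : 1 ≤ s) (hr : r < s)
    (F : Type*) [Field F] [Fintype F] (hF : Fintype.card F = p ^ s)
    (σ : F ≃+* F) (hσ : ∀ a : F, σ a = a ^ p ^ r)
    (K' : Subfield F) (q' : ℕ) (hq' : Nat.card K' = q')
    (ζ : F) (hζK : ζ ∈ K') (hζ0 : ζ ≠ 0)
    (hζ : ∀ x : F, x ∈ K' → x ≠ 0 → ∃ m' : ℕ, x = ζ ^ m')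
    (n m : ℕ) (hn : 0 < n) (hm : 0 < m)
    (idx : Fin m → ℕ) (hidx : StrictMono idx) (hidxn : ∀ j, idx j ≤ n - 1)
    (a b : Fin m → F) (ha : ∀ j, a j ≠ 0) (hb : ∀ j, b j ≠ 0) :
    ((∃ α : F, α ∈ K' ∧ α ≠ 0 ∧
        ∀ j : Fin m, a j * sNorm σ (n - idx j) ((⇑σ)^[idx j] α) = b j) ↔
      (∃ t : ℕ, ∀ j : Fin m,
        (a j)⁻¹ * b j = (sNorm σ (n - idx j) ((⇑σ)^[idx j] ζ)) ^ t)) ∧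
    (∀ u : Fin m → Fˣ,
      (∀ j : Fin m, (u j : F) = sNorm σ (n - idx j) ((⇑σ)^[idx j] ζ)) →
      (Subgroup.zpowers u).index =
        (p ^ s - 1) ^ m /
          Finset.univ.lcm (fun j : Fin m =>
            (q' - 1) / Nat.gcd (brk p r (n - idx j)) (q' - 1))) := by
  refine ⟨⟨?_, ?_⟩, fun u hu => ?_⟩
  · rintro ⟨α, hαK, hα0, hα⟩
    obtain ⟨t, rfl⟩ := hζ α hαK hα0
    refine ⟨t, fun j => ?_⟩
    rw [← hα j, inv_mul_cancel_left₀ (ha j), sNorm_iterate_pow]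
  · rintro ⟨t, ht⟩
    refine ⟨ζ ^ t, pow_mem hζK t, pow_ne_zero t hζ0, fun j => ?_⟩
    rw [sNorm_iterate_pow, ← ht j, mul_inv_cancel_left₀ (ha j)]
  · have hord : orderOf u = Finset.univ.lcm (fun j : Fin m =>
        (q' - 1) / Nat.gcd (brk p r (n - idx j)) (q' - 1)) := by
      rw [Pi.orderOf]
      refine Finset.lcm_congr rfl fun j _ => ?_
      rw [← orderOf_units, hu j, orderOf_sNorm_iterate hσ _ _ hζ0,
        orderOf_eq_natCard_subfield_sub_one K' hζK hζ0 hζ, hq']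
    have hcard : Nat.card (Fin m → Fˣ) = (p ^ s - 1) ^ m := by
      rw [Nat.card_fun, Nat.card_units, Nat.card_eq_fintype_card, hF, Nat.card_fin]
    rw [← hord, ← hcard, ← Nat.card_zpowers, ← (Subgroup.zpowers u).index_mul_card,
      Nat.mul_div_cancel _ Nat.card_pos]
end
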